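/- arXiv:2602.21753 — 2 statements merged into one kernel-verified Lean document; each statement's English description precedes it below -/
import Mathlib

section
/- Let $N_1,\dots,N_n:\mathbb{R}\to\mathbb{R}$ be integrable on a compact interval $I=[a,b]$, let $w_1,\dots,w_n>0$ be weights, let $\omega(x)=\sum_{k=1}^n w_kN_k(x)$ and assume $\omega(x)>0$ on $I$, and define the rational functions $R_i(x)=w_iN_i(x)/\omega(x)$. Let $S$ be a real $n\times n$ matrix such that the functions $\lambda_j=\sum_k S_{jk}N_k$ are exact duals of the $N_i$, i.e. $\int_I N_i(x)\lambda_j(x)\,dx=\delta_{ij}$ for all $i,j$. Define ${}^R\lambda_j:=\sum_k (w_j^{-1}S_{jk}w_k^{-1})\,R_k$. Then the $\omega^2$-weighted bi-orthogonality $\int_I R_i(x)\,{}^R\lambda_j(x)\,\omega(x)^2\,dx=\delta_{ij}$ holds for all $i,j$. -/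
open MeasureTheory

/-- If `λ_j = ∑ₖ S_{jk} Nₖ` are exact duals of the `Nᵢ` on `I = [a,b]`, then the
NURBS dual basis functions `ᴿλ_j = ∑ₖ (w_j⁻¹ S_{jk} w_k⁻¹) Rₖ` satisfy the
`ω²`-weighted bi-orthogonality with the NURBS basis functions `Rᵢ = wᵢNᵢ/ω`. -/
theorem nurbs_dual_biorthogonality
    {n : ℕ} (a b : ℝ) (N : Fin n → ℝ → ℝ)
    (hNint : ∀ i, IntegrableOn (N i) (Set.Icc a b))
    (w : Fin n → ℝ) (hw : ∀ i, 0 < w i)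
    (ω : ℝ → ℝ) (hω : ∀ x, ω x = ∑ k, w k * N k x)
    (hωpos : ∀ x ∈ Set.Icc a b, 0 < ω x)
    (R : Fin n → ℝ → ℝ) (hR : ∀ i x, R i x = w i * N i x / ω x)
    (S : Matrix (Fin n) (Fin n) ℝ)
    (lam : Fin n → ℝ → ℝ) (hlam : ∀ j x, lam j x = ∑ k, S j k * N k x)
    (hdual : ∀ i j, ∫ x in Set.Icc a b, N i x * lam j x = if i = j then (1:ℝ) else 0)
    (Rlam : Fin n → ℝ → ℝ)
    (hRlam : ∀ j x, Rlam j x = ∑ k, ((w j)⁻¹ * S j k * (w k)⁻¹) * R k x) :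
    ∀ i j, ∫ x in Set.Icc a b, R i x * Rlam j x * (ω x)^2 =
      if i = j then (1:ℝ) else 0 := by
  intro i j
  have key : ∀ x ∈ Set.Icc a b,
      R i x * Rlam j x * (ω x)^2 = (w i * (w j)⁻¹) * (N i x * lam j x) := by
    intro x hx
    have h0 : ω x ≠ 0 := (hωpos x hx).ne'
    have h1 : Rlam j x = (w j)⁻¹ * lam j x / ω x := by
      rw [hRlam, hlam, Finset.mul_sum, Finset.sum_div]
      refine Finset.sum_congr rfl fun k _ => ?_
      have hk : w k ≠ 0 := (hw k).ne'
      have hj : w j ≠ 0 := (hw j).ne'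
      rw [hR]
      field_simp
    rw [h1, hR]
    field_simp
  rw [setIntegral_congr_fun measurableSet_Icc key, integral_const_mul, hdual]
  split_ifs with h
  · subst h
    rw [mul_one, mul_inv_cancel₀ (hw i).ne']
  · rw [mul_zero]
end

section
/- Let $N_1,\dots,N_n:\mathbb{R}\to\mathbb{R}$ be integrable on a compact interval $I=[a,b]$, let $w_1,\dots,w_n>0$, $\omega=\sum_k w_kN_k>0$ on $I$, $R_i=w_iN_i/\omega$, and let $S$ be a symmetric real $n\times n$ matrix with $\lambda_j=\sum_k S_{jk}N_k$ and ${}^R\lambda_j=\sum_k (w_j^{-1}S_{jk}w_k^{-1})R_k$. Fix $r\in\mathbb{N}$ and assume the reproduction property of degree $r$ for the B-spline duals: for all $x\in I$, $x^r=\sum_{k=1}^n\big(\int_I t^r\lambda_k(t)\,dt\big)N_k(x)$. Then the weighted NURBS reproduction identity holds: for all $x\in I$, $\dfrac{x^r}{\omega(x)}=\sum_{j=1}^n\Big(\int_I \dfrac{t^r}{\omega(t)}\,R_j(t)\,\omega(t)^2\,dt\Big)\,{}^R\lambda_j(x)$. -/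
open MeasureTheory

/-- If the B-spline duals `λ_j = ∑ₖ S_{jk} Nₖ` (with `S` symmetric) reproduce the
monomial `x^r` on `I = [a,b]`, then the NURBS duals
`ᴿλ_j = ∑ₖ (w_j⁻¹ S_{jk} w_k⁻¹) Rₖ` satisfy the weighted NURBS reproduction
identity for `x^r / ω(x)`. -/
theorem nurbs_weighted_reproduction
    {n : ℕ} (a b : ℝ) (N : Fin n → ℝ → ℝ)
    (hNint : ∀ i, IntegrableOn (N i) (Set.Icc a b))
    (w : Fin n → ℝ) (hw : ∀ i, 0 < w i)
    (ω : ℝ → ℝ) (hω : ∀ x, ω x = ∑ k, w k * N k x)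
    (hωpos : ∀ x ∈ Set.Icc a b, 0 < ω x)
    (R : Fin n → ℝ → ℝ) (hR : ∀ i x, R i x = w i * N i x / ω x)
    (S : Matrix (Fin n) (Fin n) ℝ) (hS : S.IsSymm)
    (lam : Fin n → ℝ → ℝ) (hlam : ∀ j x, lam j x = ∑ k, S j k * N k x)
    (Rlam : Fin n → ℝ → ℝ)
    (hRlam : ∀ j x, Rlam j x = ∑ k, ((w j)⁻¹ * S j k * (w k)⁻¹) * R k x)
    (r : ℕ)
    (hrep : ∀ x ∈ Set.Icc a b,
      x ^ r = ∑ k, (∫ t in Set.Icc a b, t ^ r * lam k t) * N k x) :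
    ∀ x ∈ Set.Icc a b,
      x ^ r / ω x =
        ∑ j, (∫ t in Set.Icc a b, t ^ r / ω t * R j t * (ω t)^2) * Rlam j x := by
  intro x hx
  have h1 : ∀ j, ∫ t in Set.Icc a b, t ^ r / ω t * R j t * (ω t)^2
      = w j * ∫ t in Set.Icc a b, t ^ r * N j t := by
    intro j
    rw [← integral_const_mul]
    refine setIntegral_congr_fun measurableSet_Icc ?_
    intro t ht
    have := (hωpos t ht).ne'
    simp only [hR]
    field_simp
  have hint : ∀ j, IntegrableOn (fun t => t ^ r * N j t) (Set.Icc a b) := fun j =>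
    (hNint j).continuousOn_mul (continuous_pow r).continuousOn isCompact_Icc
  have h2 : ∀ k, ∫ t in Set.Icc a b, t ^ r * lam k t
      = ∑ j, S k j * ∫ t in Set.Icc a b, t ^ r * N j t := by
    intro k
    simp_rw [← integral_const_mul]
    rw [← integral_finsetSum _ (fun j _ => (hint j).const_mul (S k j))]
    congr 1
    ext t
    rw [hlam, Finset.mul_sum]
    exact Finset.sum_congr rfl fun j _ => by ring
  rw [hrep x hx]
  simp_rw [h1, h2, hRlam, hR, Finset.mul_sum, Finset.sum_mul, Finset.sum_div]
  rw [Finset.sum_comm]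
  refine Finset.sum_congr rfl fun j _ => Finset.sum_congr rfl fun k _ => ?_
  rw [hS.apply j k]
  have := (hw j).ne'
  have := (hw k).ne'
  have := (hωpos x hx).ne'
  field_simp
end
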